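/- Let s > 1/2 and let g : ℝ → ℂ be a continuous 2π-periodic function with ‖g‖_s < ∞. Then the trigonometric interpolation error in L² satisfies ‖g − Q_M g‖_{L²} ≤ C_s (1/2 + M)^{−s} ‖g‖_s. -/

import Mathlib

open Complex Real

/-- Equidistant interpolation nodes `θ_m = 2πm/(2M+1)`. -/
noncomputable def theta (M : ℕ) (m : ℤ) : ℝ := 2 * Real.pi * m / (2 * M + 1)

/-- Trigonometric interpolation basis function
`φ_m(θ) = (1/(2M+1)) Σ_{|n|≤M} e^{i n (θ - θ_m)}`. -/
noncomputable def phi (M : ℕ) (m : ℤ) (θ : ℝ) : ℂ :=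
  (1 / (2 * (M : ℂ) + 1)) * ∑ n ∈ Finset.Icc (-(M : ℤ)) (M : ℤ),
    Complex.exp (Complex.I * (n : ℂ) * ((θ - theta M m : ℝ) : ℂ))

/-- The `L²(-π,π)` inner product of two (2π-periodic) functions. -/
noncomputable def L2inner (f g : ℝ → ℂ) : ℂ :=
  ∫ θ in (-Real.pi)..Real.pi, f θ * (starRingEnd ℂ) (g θ)

/-- Trigonometric interpolation operator `Q_M g = Σ_{|m|≤M} g(θ_m) φ_m`. -/
noncomputable def QM (M : ℕ) (g : ℝ → ℂ) : ℝ → ℂ :=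
  fun θ => ∑ m ∈ Finset.Icc (-(M : ℤ)) (M : ℤ), g (theta M m) * phi M m θ

/-- Fourier coefficient `ĝ(n) = (1/(2π)) ∫_{-π}^{π} g(θ) e^{-inθ} dθ`. -/
noncomputable def fCoeff (g : ℝ → ℂ) (n : ℤ) : ℂ :=
  (1 / (2 * (Real.pi : ℂ))) *
    ∫ θ in (-Real.pi)..Real.pi, g θ * Complex.exp (-(Complex.I * (n : ℂ) * (θ : ℂ)))

/-- The periodic Sobolev norm `‖g‖_s = (2π Σ_{n∈ℤ} max(1,|n|)^{2s} |ĝ(n)|²)^{1/2}`. -/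
noncomputable def sobNorm (s : ℝ) (g : ℝ → ℂ) : ℝ :=
  Real.sqrt (2 * Real.pi * ∑' n : ℤ, (max 1 |(n : ℝ)|) ^ (2 * s) * ‖fCoeff g n‖ ^ 2)

/-- `‖g‖_s < ∞`, expressed as summability of the weighted squared Fourier coefficients. -/
def SobSummable (s : ℝ) (g : ℝ → ℂ) : Prop :=
  Summable (fun n : ℤ => (max 1 |(n : ℝ)|) ^ (2 * s) * ‖fCoeff g n‖ ^ 2)

/-- The constant `C_s = (Σ_{n≥0} max(1,n)^{-2s})^{1/2}`. -/
noncomputable def Cs (s : ℝ) : ℝ := Real.sqrt (∑' n : ℕ, (max 1 (n : ℝ)) ^ (-(2 * s)))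

lemma aux_int_exp (k : ℤ) :
    ∫ θ in (-Real.pi)..Real.pi, Complex.exp (Complex.I * (k : ℂ) * (θ : ℂ)) =
      if k = 0 then 2 * (Real.pi : ℂ) else 0 := by
  split_ifs with h
  · subst h; simp; ring
  · have hc : Complex.I * (k : ℂ) ≠ 0 := by simp [h]
    rw [integral_exp_mul_complex hc, div_eq_zero_iff]
    left
    rw [sub_eq_zero, Complex.exp_eq_exp_iff_exists_int]
    exact ⟨k, by push_cast; ring⟩

lemma aux_norm_exp (k : ℤ) (θ : ℝ) : ‖Complex.exp (Complex.I * (k : ℂ) * (θ : ℂ))‖ = 1 := by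
  rw [show Complex.I * (k : ℂ) * (θ : ℂ) = ((k * θ : ℝ) : ℂ) * Complex.I by push_cast; ring]
  exact Complex.norm_exp_ofReal_mul_I _

lemma aux_swap (a : ℤ → ℂ) (ha : Summable fun n => ‖a n‖) (u : ℝ → ℂ) (hu : Continuous u)
    (h : ℝ → ℂ)
    (hh : ∀ θ : ℝ, HasSum (fun n : ℤ => a n * Complex.exp (Complex.I * (n : ℂ) * (θ : ℂ))) (h θ)) :
    HasSum (fun n : ℤ => a n * ∫ θ in (-Real.pi)..Real.pi,
        Complex.exp (Complex.I * (n : ℂ) * (θ : ℂ)) * u θ)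
      (∫ θ in (-Real.pi)..Real.pi, h θ * u θ) := by
  obtain ⟨B, hB⟩ := (isCompact_uIcc (a := -Real.pi) (b := Real.pi)).exists_bound_of_continuousOn
    hu.continuousOn
  have := intervalIntegral.hasSum_integral_of_dominated_convergence (μ := MeasureTheory.volume)
    (a := -Real.pi) (b := Real.pi)
    (F := fun (n : ℤ) (θ : ℝ) => a n * Complex.exp (Complex.I * (n : ℂ) * (θ : ℂ)) * u θ)
    (f := fun θ => h θ * u θ)
    (fun n _ => ‖a n‖ * B)
    (fun n => (by fun_prop : Continuous _).aestronglyMeasurable)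
    (fun n => by
      filter_upwards with θ hθ
      rw [norm_mul, norm_mul, aux_norm_exp, mul_one]
      exact mul_le_mul_of_nonneg_left (hB θ (Set.uIoc_subset_uIcc hθ)) (norm_nonneg _))
    (by filter_upwards with θ hθ; exact ha.mul_right B)
    (by simp)
    (by filter_upwards with θ hθ; exact (hh θ).mul_right _)
  simpa only [mul_assoc, intervalIntegral.integral_const_mul] using this

lemma aux_parseval (c : ℤ → ℂ) (hc : Summable fun n => ‖c n‖) (h : ℝ → ℂ) (hcont : Continuous h)
    (hh : ∀ θ : ℝ, HasSum (fun n : ℤ => c n * Complex.exp (Complex.I * (n : ℂ) * (θ : ℂ))) (h θ)) :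
    HasSum (fun n => 2 * Real.pi * ‖c n‖ ^ 2) (L2inner h h).re := by
  have h1 := aux_swap c hc (fun θ => (starRingEnd ℂ) (h θ)) (by fun_prop) h hh
  have h2 : ∀ n : ℤ, ∫ θ in (-Real.pi)..Real.pi, h θ * Complex.exp (Complex.I * ((-n : ℤ) : ℂ) * (θ : ℂ))
      = 2 * Real.pi * c n := by
    intro n
    have h3 := aux_swap c hc (fun θ => Complex.exp (Complex.I * ((-n : ℤ) : ℂ) * (θ : ℂ)))
      (by fun_prop) h hh
    have h4 := hasSum_single (f := fun m : ℤ => c m * ∫ θ in (-Real.pi)..Real.pi,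
        Complex.exp (Complex.I * (m : ℂ) * (θ : ℂ)) * Complex.exp (Complex.I * ((-n : ℤ) : ℂ) * (θ : ℂ)))
        n (fun m hm => by
          have := aux_int_exp (m - n)
          rw [if_neg (sub_ne_zero.2 hm)] at this
          simp only [← Complex.exp_add]
          rw [mul_eq_zero]; right
          rw [← this]
          congr 1; ext θ; congr 1; push_cast; ring)
    rw [h3.unique h4, mul_comm]
    congr 1
    have := aux_int_exp 0
    rw [if_pos rfl] at this
    rw [← this]
    congr 1; ext θ; rw [← Complex.exp_add]; congr 1; push_cast; ring
  have h5 : ∀ n : ℤ, ∫ θ in (-Real.pi)..Real.pi,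
      Complex.exp (Complex.I * (n : ℂ) * (θ : ℂ)) * (starRingEnd ℂ) (h θ)
      = 2 * Real.pi * (starRingEnd ℂ) (c n) := by
    intro n
    have := congrArg (starRingEnd ℂ) (h2 n)
    rw [intervalIntegral.integral_of_le (by linarith [Real.pi_pos]), ← integral_conj,
      ← intervalIntegral.integral_of_le (by linarith [Real.pi_pos])] at this
    simp only [map_mul, ← Complex.exp_conj, Complex.conj_ofReal, Complex.conj_I] at this
    simp only [map_ofNat, map_intCast] at this
    rw [← this]
    congr 1; ext θ; rw [mul_comm]; congr 2; push_cast; ring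
  simp only [h5] at h1
  have h6 := Complex.hasSum_re h1
  rw [L2inner]
  convert h6 using 2 with n
  rw [show c n * (2 * (Real.pi : ℂ) * (starRingEnd ℂ) (c n)) =
    2 * (Real.pi : ℂ) * (c n * (starRingEnd ℂ) (c n)) by ring, Complex.mul_conj,
    Complex.normSq_eq_norm_sq]
  norm_cast

lemma aux_inversion (g : ℝ → ℂ) (hgc : Continuous g) (hgp : Function.Periodic g (2 * Real.pi))
    (hsum : Summable fun n => ‖fCoeff g n‖) (θ : ℝ) :
    HasSum (fun n : ℤ => fCoeff g n * Complex.exp (Complex.I * (n : ℂ) * (θ : ℂ))) (g θ) := by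
  have : Fact (0 < 2 * Real.pi) := ⟨by positivity⟩
  let G : C(AddCircle (2 * Real.pi), ℂ) := ⟨hgp.lift, continuous_coinduced_dom.mpr hgc⟩
  have hG : ∀ x : ℝ, G (x : AddCircle (2 * Real.pi)) = g x := fun x => rfl
  have hpi : (Real.pi : ℂ) ≠ 0 := by exact_mod_cast Real.pi_ne_zero
  have hcoef : ∀ n, fourierCoeff G n = fCoeff g n := by
    intro n
    rw [fourierCoeff_eq_intervalIntegral _ n (-Real.pi), fCoeff,
      show -Real.pi + 2 * Real.pi = Real.pi by ring, Complex.real_smul]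
    congr 1
    · push_cast; rfl
    · congr 1; ext x
      rw [fourier_coe_apply, hG, smul_eq_mul, mul_comm]
      congr 2; push_cast; field_simp
  have := has_pointwise_sum_fourier_series_of_summable (f := G)
    (by rw [show fourierCoeff G = fCoeff g from funext hcoef]; exact hsum.of_norm)
    (θ : AddCircle (2 * Real.pi))
  rw [hG] at this
  convert this using 2 with n
  rw [hcoef, fourier_coe_apply, smul_eq_mul]
  congr 2; push_cast; field_simp

lemma aux_discrete (M : ℕ) (j : ℤ) :
    ∑ m ∈ Finset.Icc (-(M : ℤ)) (M : ℤ), Complex.exp (Complex.I * (j : ℂ) * (theta M m : ℂ)) =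
      if ((2 * M + 1 : ℕ) : ℤ) ∣ j then 2 * (M : ℂ) + 1 else 0 := by
  have hN : (2 * (M : ℂ) + 1) ≠ 0 := by exact_mod_cast (by omega : 2 * M + 1 ≠ 0)
  have hpi : (Real.pi : ℂ) ≠ 0 := by exact_mod_cast Real.pi_ne_zero
  set z : ℂ := Complex.exp (2 * Real.pi * Complex.I * j / (2 * M + 1)) with hz
  have hre : ∑ m ∈ Finset.Icc (-(M : ℤ)) (M : ℤ), Complex.exp (Complex.I * (j : ℂ) * (theta M m : ℂ))
      = z ^ (-(M : ℤ)) * ∑ i ∈ Finset.range (2 * M + 1), z ^ i := by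
    rw [Finset.mul_sum]
    symm
    refine Finset.sum_bij (fun i _ => (i : ℤ) - M) ?_ ?_ ?_ ?_
    · intro i hi; simp at hi ⊢; omega
    · intro a _ b _ h; simpa using h
    · intro b hb; simp at hb; exact ⟨(b + M).toNat, by simp; omega, by simp; omega⟩
    · intro i _
      rw [hz, ← Complex.exp_int_mul, ← Complex.exp_nat_mul, ← Complex.exp_add, theta]
      congr 1; push_cast; field_simp; ring
  rw [hre]
  split_ifs with h
  · obtain ⟨k, rfl⟩ := h
    have : z = 1 := by
      rw [hz, Complex.exp_eq_one_iff]
      exact ⟨k, by push_cast; field_simp⟩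
    simp [this]
  · have h1 : z ≠ 1 := by
      intro h1
      rw [hz, Complex.exp_eq_one_iff] at h1
      obtain ⟨k, hk⟩ := h1
      apply h
      refine ⟨k, ?_⟩
      have h2 : (j : ℂ) = (2 * M + 1) * k := by
        have := Complex.I_ne_zero
        field_simp at hk
        linear_combination hk
      exact_mod_cast h2
    have h2 : z ^ (2 * M + 1) = 1 := by
      rw [hz, ← Complex.exp_nat_mul, Complex.exp_eq_one_iff]
      exact ⟨j, by push_cast; field_simp⟩
    rw [geom_sum_eq h1, h2]; simp

lemma aux_inj (M : ℕ) (n : ℤ) : Function.Injective (fun k : ℤ => n + k * ((2 * M + 1 : ℕ) : ℤ)) := by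
  intro a b h
  simp only [add_right_inj] at h
  exact mul_right_cancel₀ (by omega) h

/-- Summing over a residue class. -/
lemma aux_class {E : Type*} [AddCommMonoid E] [TopologicalSpace E] (M : ℕ) (n : ℤ) (f : ℤ → E)
    (a : E) :
    HasSum (fun k : ℤ => f (n + k * ((2 * M + 1 : ℕ) : ℤ))) a ↔
      HasSum (fun l : ℤ => if ((2 * M + 1 : ℕ) : ℤ) ∣ l - n then f l else 0) a := by
  rw [← (aux_inj M n).hasSum_iff (f := fun l : ℤ => if ((2 * M + 1 : ℕ) : ℤ) ∣ l - n then f l else 0)]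
  · apply iff_of_eq; congr 1; ext k
    simp only [Function.comp]
    rw [if_pos (by simp)]
  · intro x hx
    rw [if_neg]
    rintro ⟨k, hk⟩
    exact hx ⟨k, by simp only; linarith⟩

lemma aux_alias (M : ℕ) (g : ℝ → ℂ) (hgc : Continuous g)
    (hgp : Function.Periodic g (2 * Real.pi))
    (hsum : Summable fun n => ‖fCoeff g n‖) (n : ℤ) :
    HasSum (fun k : ℤ => fCoeff g (n + k * ((2 * M + 1 : ℕ) : ℤ)))
      ((1 / (2 * (M : ℂ) + 1)) * ∑ m ∈ Finset.Icc (-(M : ℤ)) (M : ℤ),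
        g (theta M m) * Complex.exp (Complex.I * ((-n : ℤ) : ℂ) * (theta M m : ℂ))) := by
  rw [aux_class]
  have hN : (2 * (M : ℂ) + 1) ≠ 0 := by exact_mod_cast (by omega : 2 * M + 1 ≠ 0)
  have := (hasSum_sum (s := Finset.Icc (-(M : ℤ)) (M : ℤ)) (fun m _ =>
    (aux_inversion g hgc hgp hsum (theta M m)).mul_right
      (Complex.exp (Complex.I * ((-n : ℤ) : ℂ) * (theta M m : ℂ))))).mul_left
      (1 / (2 * (M : ℂ) + 1))
  refine (funext fun l => ?_ : (fun l : ℤ => if ((2 * M + 1 : ℕ) : ℤ) ∣ l - n then fCoeff g l else 0) = _) ▸ this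
  have h2 := aux_discrete M (l - n)
  have h3 : ∑ i ∈ Finset.Icc (-(M : ℤ)) (M : ℤ), fCoeff g l *
      Complex.exp (Complex.I * (l : ℂ) * (theta M i : ℂ)) *
      Complex.exp (Complex.I * ((-n : ℤ) : ℂ) * (theta M i : ℂ)) =
      fCoeff g l * ∑ i ∈ Finset.Icc (-(M : ℤ)) (M : ℤ),
        Complex.exp (Complex.I * ((l - n : ℤ) : ℂ) * (theta M i : ℂ)) := by
    rw [Finset.mul_sum]
    refine Finset.sum_congr rfl fun i _ => ?_
    rw [mul_assoc, ← Complex.exp_add]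
    congr 2; push_cast; ring
  rw [h3, h2]
  split_ifs
  · field_simp
  · simp

lemma aux_QM (M : ℕ) (g : ℝ → ℂ) (hgc : Continuous g)
    (hgp : Function.Periodic g (2 * Real.pi))
    (hsum : Summable fun n => ‖fCoeff g n‖) (θ : ℝ) :
    QM M g θ = ∑ n ∈ Finset.Icc (-(M : ℤ)) (M : ℤ),
      (∑' k : ℤ, fCoeff g (n + k * ((2 * M + 1 : ℕ) : ℤ))) *
        Complex.exp (Complex.I * (n : ℂ) * (θ : ℂ)) := by
  simp only [fun n => (aux_alias M g hgc hgp hsum n).tsum_eq]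
  simp only [QM, phi, Finset.mul_sum, Finset.sum_mul]
  rw [Finset.sum_comm]
  refine Finset.sum_congr rfl fun n _ => Finset.sum_congr rfl fun m _ => ?_
  rw [show Complex.I * (n : ℂ) * ((θ - theta M m : ℝ) : ℂ) =
    Complex.I * ((-n : ℤ) : ℂ) * (theta M m : ℂ) + Complex.I * (n : ℂ) * (θ : ℂ) by
      push_cast; ring, Complex.exp_add]
  ring

lemma aux_summable_nat (s : ℝ) (hs : 1 / 2 < s) :
    Summable fun n : ℕ => (max 1 (n : ℝ)) ^ (-(2 * s)) := by
  rw [← summable_nat_add_iff 1]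
  have h := (summable_nat_add_iff 1).2 (Real.summable_nat_rpow (p := -(2 * s)) |>.2 (by linarith))
  refine h.congr fun n => ?_
  rw [max_eq_right]
  push_cast
  linarith [(Nat.cast_nonneg n : (0 : ℝ) ≤ n)]

lemma aux_summable_int (s : ℝ) (hs : 1 / 2 < s) :
    Summable fun n : ℤ => (max 1 |(n : ℝ)|) ^ (-(2 * s)) := by
  apply Summable.of_nat_of_neg <;> simpa using aux_summable_nat s hs

lemma aux_sq (s x : ℝ) (hx : 0 < x) : (x ^ s) ^ 2 = x ^ (2 * s) := by
  rw [← Real.rpow_natCast, ← Real.rpow_mul hx.le]; congr 1; push_cast; ring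

lemma aux_coeff_summable (s : ℝ) (hs : 1 / 2 < s) (g : ℝ → ℂ) (hgs : SobSummable s g) :
    Summable fun n => ‖fCoeff g n‖ := by
  refine Summable.of_nonneg_of_le (fun _ => norm_nonneg _) (fun n => ?_)
    ((aux_summable_int s hs).add hgs)
  have hx : 0 < max 1 |(n : ℝ)| := by positivity
  rw [← aux_sq s _ hx, show -(2 * s) = 2 * (-s) by ring, ← aux_sq (-s) _ hx, ← mul_pow]
  set x := max 1 |(n : ℝ)|
  have h1 : x ^ (-s) * (x ^ s * ‖fCoeff g n‖) = ‖fCoeff g n‖ := by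
    rw [← mul_assoc, ← Real.rpow_add hx]; simp
  have h2 : 0 ≤ x ^ s * ‖fCoeff g n‖ := by positivity
  have h3 : 0 ≤ x ^ (-s) := by positivity
  nlinarith [sq_nonneg (x ^ (-s) - x ^ s * ‖fCoeff g n‖), mul_nonneg h3 h2]

/-- An injection `ℤ → ℕ`. -/
def auxE (n k : ℤ) : ℕ :=
  if 0 ≤ n then (if 0 ≤ k then (2 * k).toNat else (-2 * k - 1).toNat)
  else (if k ≤ 0 then (-2 * k).toNat else (2 * k - 1).toNat)

lemma auxE_inj (n : ℤ) : Function.Injective (auxE n) := by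
  intro a b h
  unfold auxE at h
  split_ifs at h <;> omega

lemma auxE_bound (M : ℕ) (n k : ℤ) (h1 : -(M : ℤ) ≤ n) (h2 : n ≤ M) (hk : k ≠ 0) :
    1 ≤ auxE n k ∧ (1 / 2 + (M : ℝ)) * (auxE n k : ℝ) ≤
      |((n + k * ((2 * M + 1 : ℕ) : ℤ) : ℤ) : ℝ)| := by
  have h3 : 1 ≤ auxE n k := by
    unfold auxE; split_ifs <;> omega
  refine ⟨h3, ?_⟩
  have h4 : (2 * M + 1) * (auxE n k : ℤ) ≤ 2 * |n + k * ((2 * M + 1 : ℕ) : ℤ)| := by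
    unfold auxE
    push_cast
    split_ifs with c1 c2 c2
    · rw [Int.toNat_of_nonneg (by omega)]
      refine le_trans ?_ (mul_le_mul_of_nonneg_left (le_abs_self _) (by norm_num))
      nlinarith
    · rw [Int.toNat_of_nonneg (by omega)]
      refine le_trans ?_ (mul_le_mul_of_nonneg_left (neg_le_abs _) (by norm_num))
      nlinarith
    · rw [Int.toNat_of_nonneg (by omega)]
      refine le_trans ?_ (mul_le_mul_of_nonneg_left (neg_le_abs _) (by norm_num))
      nlinarith
    · rw [Int.toNat_of_nonneg (by omega)]
      refine le_trans ?_ (mul_le_mul_of_nonneg_left (le_abs_self _) (by norm_num))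
      nlinarith
  have h5 : ((2 * M + 1) * (auxE n k : ℝ)) ≤ 2 * |((n + k * ((2 * M + 1 : ℕ) : ℤ) : ℤ) : ℝ)| := by
    exact_mod_cast h4
  linarith

lemma aux_kernel (M : ℕ) (s : ℝ) (hs : 1 / 2 < s) (n : ℤ)
    (h1 : -(M : ℤ) ≤ n) (h2 : n ≤ M) :
    (Summable fun k : ℤ => if k = 0 then (0 : ℝ) else
      (max 1 |((n + k * ((2 * M + 1 : ℕ) : ℤ) : ℤ) : ℝ)|) ^ (-(2 * s))) ∧
    (∑' k : ℤ, if k = 0 then (0 : ℝ) else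
      (max 1 |((n + k * ((2 * M + 1 : ℕ) : ℤ) : ℤ) : ℝ)|) ^ (-(2 * s))) ≤
    (1 / 2 + (M : ℝ)) ^ (-(2 * s)) * (Cs s ^ 2 - 1) := by
  have hS : Summable fun k : ℤ => if k = 0 then (0 : ℝ) else
      (max 1 |((n + k * ((2 * M + 1 : ℕ) : ℤ) : ℤ) : ℝ)|) ^ (-(2 * s)) := by
    refine Summable.of_nonneg_of_le (fun k => ?_) (fun k => ?_)
      ((aux_summable_int s hs).comp_injective (aux_inj M n))
    · split_ifs <;> positivity
    · simp only [Function.comp]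
      split_ifs
      · positivity
      · exact le_rfl
  refine ⟨hS, ?_⟩
  have hnat := aux_summable_nat s hs
  have hC : Cs s ^ 2 = ∑' n : ℕ, (max 1 (n : ℝ)) ^ (-(2 * s)) :=
    Real.sq_sqrt (tsum_nonneg fun n => by positivity)
  have hz : Cs s ^ 2 - 1 = ∑' j : ℕ, if j = 0 then (0 : ℝ) else (max 1 (j : ℝ)) ^ (-(2 * s)) := by
    rw [hC, hnat.tsum_eq_add_tsum_ite 0]; simp
  have hz2 : Summable fun j : ℕ => if j = 0 then (0 : ℝ) else (max 1 (j : ℝ)) ^ (-(2 * s)) := by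
    refine Summable.of_nonneg_of_le (fun k => ?_) (fun k => ?_) hnat
    · split_ifs <;> positivity
    · split_ifs
      · positivity
      · exact le_rfl
  rw [hz, ← tsum_mul_left]
  refine Summable.tsum_le_tsum_of_inj (auxE n) (auxE_inj n) (fun c _ => ?_) (fun k => ?_) hS
    (hz2.mul_left _)
  · split_ifs <;> positivity
  · split_ifs with a b b
    · simp
    · positivity
    · exact absurd b (by have := (auxE_bound M n k h1 h2 a).1; omega)
    · obtain ⟨b1, b2⟩ := auxE_bound M n k h1 h2 a
      have b1' : (1 : ℝ) ≤ auxE n k := by exact_mod_cast b1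
      rw [max_eq_right b1', ← Real.mul_rpow (by positivity) (by positivity)]
      refine Real.rpow_le_rpow_of_nonpos (by positivity) (b2.trans (le_max_right _ _)) (by linarith)


lemma aux_cs (f g : ℤ → ℝ) (hf : ∀ i, 0 ≤ f i) (hg : ∀ i, 0 ≤ g i)
    (hfs : Summable fun i => f i ^ 2) (hgs : Summable fun i => g i ^ 2) :
    (∑' i, f i * g i) ^ 2 ≤ (∑' i, f i ^ 2) * ∑' i, g i ^ 2 := by
  have h := Real.inner_le_Lp_mul_Lq_tsum_of_nonneg (p := 2) (q := 2) (f := f) (g := g)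
    (by constructor <;> norm_num) hf hg (by simpa using hfs) (by simpa using hgs)
  simp only [Real.rpow_two, ← Real.sqrt_eq_rpow] at h
  have h0 : 0 ≤ ∑' i, f i * g i := tsum_nonneg fun i => mul_nonneg (hf i) (hg i)
  have h1 : 0 ≤ ∑' i, f i ^ 2 := tsum_nonneg fun i => sq_nonneg _
  have h2 : 0 ≤ ∑' i, g i ^ 2 := tsum_nonneg fun i => sq_nonneg _
  calc _ ≤ _ := pow_le_pow_left₀ h0 h 2
    _ = _ := by rw [mul_pow, Real.sq_sqrt h1, Real.sq_sqrt h2]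

lemma aux_inner_bound (M : ℕ) (s : ℝ) (hs : 1 / 2 < s) (g : ℝ → ℂ) (hgs : SobSummable s g) (n : ℤ)
    (h1 : -(M : ℤ) ≤ n) (h2 : n ≤ M) :
    ‖fCoeff g n - ∑' k : ℤ, fCoeff g (n + k * ((2 * M + 1 : ℕ) : ℤ))‖ ^ 2 ≤
      (1 / 2 + (M : ℝ)) ^ (-(2 * s)) * (Cs s ^ 2 - 1) *
      ∑' k : ℤ, (max 1 |((n + k * ((2 * M + 1 : ℕ) : ℤ) : ℤ) : ℝ)|) ^ (2 * s) *
        ‖fCoeff g (n + k * ((2 * M + 1 : ℕ) : ℤ))‖ ^ 2 := by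
  have hsum := aux_coeff_summable s hs g hgs
  have hsumN : Summable fun k : ℤ => ‖fCoeff g (n + k * ((2 * M + 1 : ℕ) : ℤ))‖ :=
    hsum.comp_injective (aux_inj M n)
  have hw : Summable fun k : ℤ => (max 1 |((n + k * ((2 * M + 1 : ℕ) : ℤ) : ℤ) : ℝ)|) ^ (2 * s) *
        ‖fCoeff g (n + k * ((2 * M + 1 : ℕ) : ℤ))‖ ^ 2 :=
    Summable.comp_injective hgs (aux_inj M n)
  obtain ⟨k1, k2⟩ := aux_kernel M s hs n h1 h2
  set L : ℤ → ℤ := fun k => n + k * ((2 * M + 1 : ℕ) : ℤ) with hL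
  let F : ℤ → ℝ := fun k => if k = 0 then 0 else (max 1 |(L k : ℝ)|) ^ (-s)
  let G : ℤ → ℝ := fun k => (max 1 |(L k : ℝ)|) ^ s * ‖fCoeff g (L k)‖
  have hpos : ∀ k, 0 < max 1 |(L k : ℝ)| := fun k => by positivity
  have hF2 : ∀ k, F k ^ 2 = if k = 0 then (0 : ℝ) else (max 1 |(L k : ℝ)|) ^ (-(2 * s)) := by
    intro k
    simp only [F]
    split_ifs
    · simp
    · rw [aux_sq _ _ (hpos k)]; congr 1; ring
  have hG2 : ∀ k, G k ^ 2 = (max 1 |(L k : ℝ)|) ^ (2 * s) * ‖fCoeff g (L k)‖ ^ 2 := by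
    intro k; simp only [G]; rw [mul_pow, aux_sq _ _ (hpos k)]
  have hFG : ∀ k, F k * G k = ‖if k = 0 then 0 else fCoeff g (L k)‖ := by
    intro k
    simp only [F, G]
    split_ifs
    · simp
    · rw [← mul_assoc, ← Real.rpow_add (hpos k)]; simp
  have hcs := aux_cs F G (fun k => by simp only [F]; split_ifs <;> positivity)
    (fun k => by simp only [G]; positivity)
    (by simp only [hF2]; exact k1) (by simp only [hG2]; exact hw)
  simp only [hF2, hG2, hFG] at hcs
  have hn : fCoeff g n - ∑' k : ℤ, fCoeff g (L k) = -∑' k : ℤ, if k = 0 then 0 else fCoeff g (L k) := by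
    rw [hsumN.of_norm.tsum_eq_add_tsum_ite 0]
    simp [hL]
  have hsumI : Summable fun k : ℤ => ‖if k = 0 then 0 else fCoeff g (L k)‖ := by
    refine Summable.of_nonneg_of_le (fun k => norm_nonneg _) (fun k => ?_) hsumN
    split_ifs
    · simp
    · exact le_rfl
  have e1 : ‖fCoeff g n - ∑' k : ℤ, fCoeff g (L k)‖ ≤
      ∑' k : ℤ, ‖if k = 0 then 0 else fCoeff g (L k)‖ := by
    rw [hn, norm_neg]; exact norm_tsum_le_tsum_norm hsumI
  calc _ ≤ _ := pow_le_pow_left₀ (norm_nonneg _) e1 2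
    _ ≤ _ := hcs
    _ ≤ _ := mul_le_mul_of_nonneg_right k2 (tsum_nonneg fun k => by positivity)

lemma aux_classes (M : ℕ) (w : ℤ → ℝ) (hw0 : ∀ l, 0 ≤ w l) (hw : Summable w) :
    ∑ n ∈ Finset.Icc (-(M : ℤ)) (M : ℤ), ∑' k : ℤ, w (n + k * ((2 * M + 1 : ℕ) : ℤ)) ≤ ∑' l, w l := by
  have h := hasSum_sum (s := Finset.Icc (-(M : ℤ)) (M : ℤ)) (fun n _ =>
    (aux_class M n w _).1 (hw.comp_injective (aux_inj M n)).hasSum)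
  refine hasSum_le (fun l => ?_) h hw.hasSum
  by_cases he : ∃ n ∈ Finset.Icc (-(M : ℤ)) (M : ℤ), ((2 * M + 1 : ℕ) : ℤ) ∣ l - n
  · obtain ⟨n, hn, hd⟩ := he
    rw [Finset.sum_eq_single_of_mem n hn, if_pos hd]
    intro b hb hbn
    rw [if_neg]
    intro hd2
    have h3 : ((2 * M + 1 : ℕ) : ℤ) ∣ b - n := by
      have := dvd_sub hd hd2
      rwa [show l - n - (l - b) = b - n by ring] at this
    have h4 := Int.eq_zero_of_abs_lt_dvd h3 (by
      simp only [Finset.mem_Icc] at hn hb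
      rw [abs_lt]; push_cast; constructor <;> omega)
    omega
  · push Not at he
    rw [Finset.sum_eq_zero fun n hn => if_neg (he n hn)]
    exact hw0 l

lemma aux_Cs (s : ℝ) (hs : 1 / 2 < s) : 1 ≤ Cs s ^ 2 := by
  rw [Cs, Real.sq_sqrt (tsum_nonneg fun n => by positivity)]
  have := (aux_summable_nat s hs).le_tsum 0 (fun j _ => by positivity)
  simpa using this

/-- Interpolation error in `L²`: for `s > 1/2` and continuous
2π-periodic `g` with `‖g‖_s < ∞`, `‖g - Q_M g‖_{L²} ≤ C_s (1/2 + M)^{-s} ‖g‖_s`. -/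
theorem stmt_16 (M : ℕ) (hM : 1 ≤ M) (s : ℝ) (hs : 1 / 2 < s) (g : ℝ → ℂ)
    (hgc : Continuous g) (hgp : Function.Periodic g (2 * Real.pi)) (hgs : SobSummable s g) :
    Real.sqrt (L2inner (fun θ => g θ - QM M g θ) (fun θ => g θ - QM M g θ)).re ≤
      Cs s * (1 / 2 + (M : ℝ)) ^ (-s) * sobNorm s g := by
  have hsum := aux_coeff_summable s hs g hgs
  set R : ℝ := (1 / 2 + (M : ℝ)) ^ (-(2 * s)) with hR
  have hR0 : 0 ≤ R := by positivity
  have hC1 := aux_Cs s hs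
  set S := Finset.Icc (-(M : ℤ)) (M : ℤ) with hS
  set A : ℤ → ℂ := fun n => ∑' k : ℤ, fCoeff g (n + k * ((2 * M + 1 : ℕ) : ℤ)) with hA
  set w : ℤ → ℝ := fun n => (max 1 |(n : ℝ)|) ^ (2 * s) * ‖fCoeff g n‖ ^ 2 with hw
  have hw0 : ∀ l, 0 ≤ w l := fun l => by simp only [hw]; positivity
  have hws : Summable w := hgs
  set B : ℤ → ℂ := fun n => if n ∈ S then A n else 0 with hB
  have hBs : Summable fun n => ‖B n‖ :=
    summable_of_ne_finset_zero (s := S) (L := SummationFilter.unconditional ℤ) (fun n hn => by simp [hB, hn])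
  have hQ : ∀ θ : ℝ, HasSum (fun n : ℤ => B n * Complex.exp (Complex.I * (n : ℂ) * (θ : ℂ)))
      (QM M g θ) := by
    intro θ
    rw [aux_QM M g hgc hgp hsum θ]
    have := hasSum_sum_of_ne_finset_zero (s := S) (L := SummationFilter.unconditional ℤ)
      (f := fun n : ℤ => B n * Complex.exp (Complex.I * (n : ℂ) * (θ : ℂ)))
      (fun n hn => by simp [hB, hn])
    convert this using 1
    refine Finset.sum_congr rfl fun n hn => ?_
    simp only [hB]
    rw [if_pos hn]
  have hQc : Continuous (QM M g) := by
    unfold QM phi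
    fun_prop
  have hP := aux_parseval (fun n => fCoeff g n - B n)
    (Summable.of_nonneg_of_le (fun _ => norm_nonneg _) (fun n => norm_sub_le _ _) (hsum.add hBs))
    (fun θ => g θ - QM M g θ) (hgc.sub hQc)
    (fun θ => by
      simpa only [sub_mul] using (aux_inversion g hgc hgp hsum θ).sub (hQ θ))
  set V : ℤ → ℝ := fun n => ∑' k : ℤ, w (n + k * ((2 * M + 1 : ℕ) : ℤ)) with hV
  have hU1 := hasSum_sum_of_ne_finset_zero (s := S) (L := SummationFilter.unconditional ℤ)
      (f := fun n : ℤ => if n ∈ S then R * (Cs s ^ 2 - 1) * V n else 0)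
      (fun n hn => by simp [hn])
  have hU := (hU1.add (hws.hasSum.mul_left R)).mul_left (2 * Real.pi)
  have hle := hasSum_le (fun n => ?_) hP hU
  · have hsumS : ∑ n ∈ S, (if n ∈ S then R * (Cs s ^ 2 - 1) * V n else 0) ≤
        R * (Cs s ^ 2 - 1) * ∑' l, w l := by
      rw [Finset.sum_congr rfl (fun n hn => if_pos hn), ← Finset.mul_sum]
      exact mul_le_mul_of_nonneg_left (aux_classes M w hw0 hws)
        (mul_nonneg hR0 (by linarith))
    have hW0 : 0 ≤ ∑' l, w l := tsum_nonneg hw0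
    have hfin : (L2inner (fun θ => g θ - QM M g θ) (fun θ => g θ - QM M g θ)).re ≤
        (Cs s * (1 / 2 + (M : ℝ)) ^ (-s) * sobNorm s g) ^ 2 := by
      refine hle.trans ?_
      rw [mul_pow, mul_pow, aux_sq (-s) _ (by positivity), sobNorm, Real.sq_sqrt (by positivity),
        show 2 * -s = -(2 * s) by ring, ← hR]
      calc _ ≤ 2 * Real.pi * (R * (Cs s ^ 2 - 1) * ∑' l, w l + R * ∑' l, w l) :=
            mul_le_mul_of_nonneg_left (by linarith) (by positivity)
        _ = _ := by ring
    refine Real.sqrt_le_iff.2 ⟨?_, hfin⟩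
    have a1 : 0 ≤ Cs s := Real.sqrt_nonneg _
    have a2 : 0 ≤ sobNorm s g := Real.sqrt_nonneg _
    positivity
  · refine mul_le_mul_of_nonneg_left ?_ (by positivity)
    by_cases hn : n ∈ S
    · simp only [hB, if_pos hn]
      have hn' := Finset.mem_Icc.1 hn
      have := aux_inner_bound M s hs g hgs n hn'.1 hn'.2
      have h3 : 0 ≤ R * w n := mul_nonneg hR0 (hw0 n)
      calc _ ≤ _ := this
        _ ≤ _ := le_add_of_nonneg_right h3
    · simp only [hB, if_neg hn, sub_zero, zero_add]
      have hM1 : (1 / 2 + (M : ℝ)) ≤ max 1 |(n : ℝ)| := by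
        refine le_trans ?_ (le_max_right _ _)
        have : (M : ℤ) + 1 ≤ |n| := by
          rw [hS, Finset.mem_Icc] at hn
          rcases abs_cases n with h | h <;> omega
        have : (M : ℝ) + 1 ≤ |(n : ℝ)| := by exact_mod_cast this
        linarith
      have h4 : (1 / 2 + (M : ℝ)) ^ (2 * s) ≤ (max 1 |(n : ℝ)|) ^ (2 * s) :=
        Real.rpow_le_rpow (by positivity) hM1 (by linarith)
      have h5 : R * (1 / 2 + (M : ℝ)) ^ (2 * s) = 1 := by
        rw [hR, ← Real.rpow_add (by positivity)]; simp
      have h6 : 1 ≤ R * (max 1 |(n : ℝ)|) ^ (2 * s) := by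
        exact h5.symm.le.trans (mul_le_mul_of_nonneg_left h4 hR0)
      simp only [hw]
      rw [← mul_assoc]
      exact le_mul_of_one_le_left (by positivity) h6
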